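/- arXiv:2409.19977 — 2 statements merged into one kernel-verified Lean document; each statement's English description precedes it below -/
import Mathlib

section
/- Let n ∈ ℕ and let h_μ, h_σ₁, h_σ₂, r_μ, r_σ, t_μ, t_σ₁, t_σ₂ ∈ ℝⁿ satisfy, componentwise, r_σ ⊙ h_σ₁ > 0, r_σ ⊙ h_σ₂ > 0, t_σ₁ > 0 and t_σ₂ > 0. Let x₀ be the product over i of the standard Gaussian measure gaussianReal 0 1. Define F : ℝⁿ → ℝⁿ componentwise by F(x)ᵢ = r_σᵢ·(h_σ₁ᵢ·xᵢ + h_μᵢ) + r_μᵢ if xᵢ ≤ 0 and F(x)ᵢ = r_σᵢ·(h_σ₂ᵢ·xᵢ + h_μᵢ) + r_μᵢ if xᵢ > 0, and G : ℝⁿ → ℝⁿ componentwise by G(x)ᵢ = t_σ₁ᵢ·xᵢ + t_μᵢ if xᵢ ≤ 0 and G(x)ᵢ = t_σ₂ᵢ·xᵢ + t_μᵢ if xᵢ > 0. Then W₂²(F_*x₀, G_*x₀) = ‖r_σ ⊙ h_μ + r_μ − t_μ‖² + (1/2)‖|r_σ ⊙ h_σ₁| − |t_σ₁|‖² + (1/2)‖|r_σ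 ⊙ h_σ₂| − |t_σ₂|‖² + √(2/π)·⟨r_σ ⊙ h_μ + r_μ − t_μ, |r_σ ⊙ h_σ₂| − |r_σ ⊙ h_σ₁| + |t_σ₁| − |t_σ₂|⟩. -/
open MeasureTheory ProbabilityTheory
open scoped ENNReal NNReal

/-- Squared 2-Wasserstein distance between two measures on `ℝⁿ = (Fin n → ℝ)` with the
Euclidean norm `‖x - y‖² = ∑ i, (x i - y i)²`: the infimum over all couplings `γ` of `p` and
`q` of `∫ ‖x - y‖² dγ(x, y)`. -/
noncomputable def W2sqPi {n : ℕ} (p q : Measure (Fin n → ℝ)) : ℝ :=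
  sInf { c | ∃ γ : Measure ((Fin n → ℝ) × (Fin n → ℝ)), IsProbabilityMeasure γ ∧
    γ.map Prod.fst = p ∧ γ.map Prod.snd = q ∧ c = ∫ z, ∑ i, (z.1 i - z.2 i) ^ 2 ∂γ }

/-- Kantorovich duality certificate for a coordinatewise sum of squares: a coupling `(X, Y)` on
which a pair of separable dual potentials is tight is optimal. -/
lemma W2sqPi_map_eq_of_potentials {Ω : Type*} [MeasurableSpace Ω] {P : Measure Ω}
    [IsProbabilityMeasure P] {n : ℕ} {X Y : Ω → Fin n → ℝ} (hX : Measurable X) (hY : Measurable Y)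
    (hX2 : ∀ i, Integrable (fun ω => X ω i ^ 2) P) (hY2 : ∀ i, Integrable (fun ω => Y ω i ^ 2) P)
    {f g : Fin n → ℝ → ℝ} (hf : ∀ i, Measurable (f i)) (hg : ∀ i, Measurable (g i))
    (hfX : ∀ i, Integrable (fun ω => f i (X ω i)) P)
    (hgY : ∀ i, Integrable (fun ω => g i (Y ω i)) P)
    (hle : ∀ i x y, f i x + g i y ≤ (x - y) ^ 2)
    (heq : ∀ i ω, f i (X ω i) + g i (Y ω i) = (X ω i - Y ω i) ^ 2) :
    W2sqPi (P.map X) (P.map Y) = ∑ i, ∫ ω, (X ω i - Y ω i) ^ 2 ∂P := by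
  have hint : ∀ i, Integrable (fun ω => (X ω i - Y ω i) ^ 2) P := fun i =>
    ((hfX i).add (hgY i)).congr (.of_forall (heq i))
  have hfm : ∀ i, Measurable fun x : Fin n → ℝ => f i (x i) :=
    fun i => (hf i).comp (measurable_pi_apply i)
  have hgm : ∀ i, Measurable fun x : Fin n → ℝ => g i (x i) :=
    fun i => (hg i).comp (measurable_pi_apply i)
  have hsq : ∀ i, Measurable fun x : Fin n → ℝ => x i ^ 2 := fun i => by fun_prop
  refine IsLeast.csInf_eq ⟨⟨P.map fun ω => (X ω, Y ω), ?_, ?_, ?_, ?_⟩, ?_⟩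
  · exact Measure.isProbabilityMeasure_map (hX.prodMk hY).aemeasurable
  · rw [Measure.map_map measurable_fst (hX.prodMk hY)]; rfl
  · rw [Measure.map_map measurable_snd (hX.prodMk hY)]; rfl
  · rw [integral_map (hX.prodMk hY).aemeasurable
      (Measurable.aestronglyMeasurable (by fun_prop)), integral_finsetSum _ fun i _ => hint i]
  · rintro c ⟨γ, -, h1, h2, rfl⟩
    have transfer : ∀ {X : Ω → Fin n → ℝ}, Measurable X →
        ∀ {π : (Fin n → ℝ) × (Fin n → ℝ) → Fin n → ℝ}, Measurable π → γ.map π = P.map X →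
        ∀ {φ : (Fin n → ℝ) → ℝ}, Measurable φ → Integrable (fun ω => φ (X ω)) P →
        Integrable (fun z => φ (π z)) γ ∧ ∫ z, φ (π z) ∂γ = ∫ ω, φ (X ω) ∂P := by
      intro X hX π hπ h φ hφ hi
      constructor
      · refine Integrable.comp_measurable ?_ hπ
        rw [h]
        exact (integrable_map_measure hφ.aestronglyMeasurable hX.aemeasurable).2 hi
      · rw [← integral_map hπ.aemeasurable hφ.aestronglyMeasurable, h,
          integral_map hX.aemeasurable hφ.aestronglyMeasurable]
    have tf := fun i => transfer hX measurable_fst h1 (hfm i) (hfX i)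
    have tg := fun i => transfer hY measurable_snd h2 (hgm i) (hgY i)
    have hc : ∀ i, Integrable (fun z : (Fin n → ℝ) × (Fin n → ℝ) => (z.1 i - z.2 i) ^ 2) γ := by
      intro i
      have hx := (transfer hX measurable_fst h1 (hsq i) (hX2 i)).1
      have hy := (transfer hY measurable_snd h2 (hsq i) (hY2 i)).1
      refine ((hx.add hy).const_mul 2).mono' (Measurable.aestronglyMeasurable (by fun_prop)) ?_
      refine .of_forall fun z => ?_
      rw [Real.norm_of_nonneg (sq_nonneg _)]
      simp only [Pi.add_apply]
      nlinarith [sq_nonneg (z.1 i + z.2 i)]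
    rw [integral_finsetSum _ fun i _ => hc i]
    refine Finset.sum_le_sum fun i _ => ?_
    calc ∫ ω, (X ω i - Y ω i) ^ 2 ∂P
        = ∫ z, (f i (z.1 i) + g i (z.2 i)) ∂γ := by
          rw [integral_add (tf i).1 (tg i).1, (tf i).2, (tg i).2,
            ← integral_add (hfX i) (hgY i)]
          simp only [heq]
      _ ≤ ∫ z, (z.1 i - z.2 i) ^ 2 ∂γ :=
          integral_mono ((tf i).1.add (tg i).1) (hc i) fun z => hle i _ _

lemma integrable_sq_stdGaussian : Integrable (fun x : ℝ => x ^ 2) (gaussianReal 0 1) :=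
  (memLp_id_gaussianReal' 2 (by simp)).integrable_sq

lemma integrable_id_stdGaussian : Integrable (fun x : ℝ => x) (gaussianReal 0 1) :=
  (memLp_id_gaussianReal' 1 (by simp)).integrable (by simp)

lemma integral_sq_stdGaussian : ∫ x, x ^ 2 ∂gaussianReal 0 1 = 1 := by
  have h := variance_id_gaussianReal (μ := 0) (v := 1)
  rw [variance_eq_integral aemeasurable_id] at h
  simpa [integral_id_gaussianReal] using h

lemma integral_mul_abs_stdGaussian : ∫ x, x * |x| ∂gaussianReal 0 1 = 0 := by
  have h : ∫ x, x * |x| ∂(gaussianReal 0 1).map (fun x => -x) =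
      ∫ x, -(x * |x|) ∂gaussianReal 0 1 := by
    rw [integral_map (by fun_prop) (Measurable.aestronglyMeasurable (by fun_prop))]
    simp
  rw [gaussianReal_map_neg, neg_zero, integral_neg] at h
  linarith

lemma integral_abs_stdGaussian : ∫ x, |x| ∂gaussianReal 0 1 = √(2 / Real.pi) := by
  rw [integral_gaussianReal_eq_integral_smul one_ne_zero]
  have h1 : ∀ x : ℝ, gaussianPDFReal 0 1 x • |x| =
      (fun y => (√(2 * Real.pi))⁻¹ * (y ^ (1 : ℝ) * Real.exp (-(1 / 2) * y ^ (2 : ℝ)))) |x| := by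
    intro x
    simp only [gaussianPDFReal, smul_eq_mul, Real.rpow_one, Real.rpow_two, sq_abs, NNReal.coe_one,
      sub_zero, mul_one]
    rw [show -x ^ 2 / 2 = -(1 / 2) * x ^ 2 by ring]
    ring
  rw [integral_congr_ae (.of_forall h1), integral_comp_abs (f := fun y =>
      (√(2 * Real.pi))⁻¹ * (y ^ (1 : ℝ) * Real.exp (-(1 / 2) * y ^ (2 : ℝ)))), integral_const_mul,
    integral_rpow_mul_exp_neg_mul_rpow two_pos (by norm_num) (by norm_num)]
  norm_num [Real.rpow_neg_one]
  have := Real.pi_pos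
  have h2 : √2 * √2 = 2 := Real.mul_self_sqrt (by norm_num)
  field_simp
  nlinarith

lemma integrable_ite_quadratic_stdGaussian (a b c a' b' c' : ℝ) :
    Integrable (fun x : ℝ => if x ≤ 0 then a * x ^ 2 + b * x + c else a' * x ^ 2 + b' * x + c')
      (gaussianReal 0 1) := by
  have h : ∀ a b c : ℝ, Integrable (fun x : ℝ => a * x ^ 2 + b * x + c) (gaussianReal 0 1) :=
    fun a b c => ((integrable_sq_stdGaussian.const_mul a).add
      (integrable_id_stdGaussian.const_mul b)).add (integrable_const c)
  exact Integrable.piecewise (s := Set.Iic 0) measurableSet_Iic (h a b c).integrableOn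
    (h a' b' c').integrableOn

lemma integral_sq_ite_affine_stdGaussian (a b m : ℝ) :
    ∫ x, (if x ≤ 0 then a * x + m else b * x + m) ^ 2 ∂gaussianReal 0 1 =
      m ^ 2 + 1 / 2 * a ^ 2 + 1 / 2 * b ^ 2 + √(2 / Real.pi) * (m * (b - a)) := by
  have h : ∀ x : ℝ, (if x ≤ 0 then a * x + m else b * x + m) ^ 2 =
      (m ^ 2 + (a ^ 2 + b ^ 2) / 2 * x ^ 2) + m * (a + b) * x
        + ((b ^ 2 - a ^ 2) / 2 * (x * |x|) + m * (b - a) * |x|) := by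
    intro x
    split_ifs with hx
    · rw [abs_of_nonpos hx]; ring
    · rw [abs_of_pos (not_le.1 hx)]; ring
  have i1 := integrable_sq_stdGaussian
  have i2 := integrable_id_stdGaussian
  have i3 : Integrable (fun x : ℝ => x * |x|) (gaussianReal 0 1) :=
    i1.mono (Measurable.aestronglyMeasurable (by fun_prop)) (.of_forall fun x => by simp [sq])
  have i4 : Integrable (fun x : ℝ => |x|) (gaussianReal 0 1) := i2.abs
  have j1 : Integrable (fun x : ℝ => m ^ 2 + (a ^ 2 + b ^ 2) / 2 * x ^ 2) (gaussianReal 0 1) :=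
    (integrable_const _).add (i1.const_mul _)
  have j2 : Integrable (fun x : ℝ => m ^ 2 + (a ^ 2 + b ^ 2) / 2 * x ^ 2 + m * (a + b) * x)
      (gaussianReal 0 1) := j1.add (i2.const_mul _)
  have j3 : Integrable (fun x : ℝ => (b ^ 2 - a ^ 2) / 2 * (x * |x|) + m * (b - a) * |x|)
      (gaussianReal 0 1) := (i3.const_mul _).add (i4.const_mul _)
  simp_rw [h]
  rw [integral_add j2 j3, integral_add j1 (i2.const_mul _),
    integral_add (integrable_const _) (i1.const_mul _),
    integral_add (i3.const_mul _) (i4.const_mul _), integral_const_mul (m * (a + b)) fun x : ℝ => x,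
    integral_id_gaussianReal]
  simp only [integral_const_mul, integral_sq_stdGaussian, integral_mul_abs_stdGaussian,
    integral_abs_stdGaussian, integral_const, probReal_univ]
  simp only [smul_eq_mul]
  ring

/-- Dual potential, with respect to the squared distance, of the increasing map that is affine with
slope `k` to the left of `p` and slope `l` to its right, where `m` is the displacement at `p`. -/
noncomputable def kinkPotential (k l p m x : ℝ) : ℝ :=
  if x ≤ p then (1 - k) * (x - p) ^ 2 + 2 * m * (x - p) else (1 - l) * (x - p) ^ 2 + 2 * m * (x - p)

lemma measurable_kinkPotential (k l p m : ℝ) : Measurable (kinkPotential k l p m) :=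
  Measurable.ite measurableSet_Iic (by fun_prop) (by fun_prop)

lemma kinkPotential_add_le {k l : ℝ} (hk : 0 < k) (hl : 0 < l) (p q x y : ℝ) :
    kinkPotential k l p (p - q) x + (kinkPotential k⁻¹ l⁻¹ q (q - p) y + (p - q) ^ 2)
      ≤ (x - y) ^ 2 := by
  have young : ∀ {k : ℝ}, 0 < k → ∀ u v : ℝ, 2 * (u * v) ≤ k * u ^ 2 + k⁻¹ * v ^ 2 := by
    intro k hk u v
    have h : k * u ^ 2 + k⁻¹ * v ^ 2 - 2 * (u * v) = k⁻¹ * (k * u - v) ^ 2 := by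
      field_simp
      ring
    have : 0 ≤ k⁻¹ * (k * u - v) ^ 2 := by positivity
    linarith
  have key : ∀ {s t : ℝ}, 2 * ((x - p) * (y - q)) ≤ s * (x - p) ^ 2 + t * (y - q) ^ 2 →
      ((1 - s) * (x - p) ^ 2 + 2 * (p - q) * (x - p)) +
        (((1 - t) * (y - q) ^ 2 + 2 * (q - p) * (y - q)) + (p - q) ^ 2) ≤ (x - y) ^ 2 := by
    intro s t h
    linear_combination h
  unfold kinkPotential
  split_ifs with hx hy hy
  · exact key (young hk _ _)
  · refine key (le_trans (b := 0) ?_ (by positivity))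
    nlinarith [mul_nonneg (sub_nonneg.2 hx) (sub_nonneg.2 (not_le.1 hy).le)]
  · refine key (le_trans (b := 0) ?_ (by positivity))
    nlinarith [mul_nonneg (sub_nonneg.2 hy) (sub_nonneg.2 (not_le.1 hx).le)]
  · exact key (young hl _ _)

lemma kinkPotential_ite_affine (k l p m : ℝ) {a b : ℝ} (ha : 0 < a) (hb : 0 < b) (w : ℝ) :
    kinkPotential k l p m (if w ≤ 0 then a * w + p else b * w + p) =
      if w ≤ 0 then (1 - k) * a ^ 2 * w ^ 2 + 2 * m * a * w + 0
      else (1 - l) * b ^ 2 * w ^ 2 + 2 * m * b * w + 0 := by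
  unfold kinkPotential
  split_ifs with hw h h
  · ring
  · nlinarith
  · nlinarith
  · ring

lemma W2sqPi_map_ite_affine_pi_stdGaussian {n : ℕ} {a b c d p q : Fin n → ℝ}
    (ha : ∀ i, 0 < a i) (hb : ∀ i, 0 < b i) (hc : ∀ i, 0 < c i) (hd : ∀ i, 0 < d i) :
    W2sqPi
      ((Measure.pi fun _ : Fin n => gaussianReal 0 1).map
        fun x i => if x i ≤ 0 then a i * x i + p i else b i * x i + p i)
      ((Measure.pi fun _ : Fin n => gaussianReal 0 1).map
        fun x i => if x i ≤ 0 then c i * x i + q i else d i * x i + q i) =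
      ∑ i, ((p i - q i) ^ 2 + 1 / 2 * (a i - c i) ^ 2 + 1 / 2 * (b i - d i) ^ 2
        + √(2 / Real.pi) * ((p i - q i) * ((b i - d i) - (a i - c i)))) := by
  have hm : ∀ a b p : Fin n → ℝ, Measurable fun (x : Fin n → ℝ) (i : Fin n) =>
      if x i ≤ 0 then a i * x i + p i else b i * x i + p i := fun a b p =>
    measurable_pi_lambda _ fun i => Measurable.ite
      (measurableSet_le (measurable_pi_apply i) measurable_const) (by fun_prop) (by fun_prop)
  have hi : ∀ (a b p : Fin n → ℝ) (i : Fin n), Integrable (fun x : Fin n → ℝ =>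
      (if x i ≤ 0 then a i * x i + p i else b i * x i + p i) ^ 2)
      (Measure.pi fun _ : Fin n => gaussianReal 0 1) := fun a b p i => by
    refine integrable_comp_eval (μ := fun _ : Fin n => gaussianReal 0 1) (i := i)
      (f := fun t => (if t ≤ 0 then a i * t + p i else b i * t + p i) ^ 2) ?_
    refine (integrable_ite_quadratic_stdGaussian (a i ^ 2) (2 * a i * p i) (p i ^ 2)
      (b i ^ 2) (2 * b i * p i) (p i ^ 2)).congr (.of_forall fun t => ?_)
    dsimp only
    split_ifs <;> ring
  have hpot : ∀ (k l m a b p : Fin n → ℝ), (∀ i, 0 < a i) → (∀ i, 0 < b i) → ∀ i : Fin n,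
      Integrable (fun x : Fin n → ℝ => kinkPotential (k i) (l i) (p i) (m i)
        (if x i ≤ 0 then a i * x i + p i else b i * x i + p i))
      (Measure.pi fun _ : Fin n => gaussianReal 0 1) := fun k l m a b p ha hb i => by
    simp only [kinkPotential_ite_affine _ _ _ _ (ha i) (hb i)]
    exact integrable_comp_eval (μ := fun _ : Fin n => gaussianReal 0 1) (i := i)
      (integrable_ite_quadratic_stdGaussian _ _ _ _ _ _)
  rw [W2sqPi_map_eq_of_potentials (hm a b p) (hm c d q) (hi a b p) (hi c d q)
    (f := fun i => kinkPotential (c i / a i) (d i / b i) (p i) (p i - q i))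
    (g := fun i y => kinkPotential (c i / a i)⁻¹ (d i / b i)⁻¹ (q i) (q i - p i) y
      + (p i - q i) ^ 2)
    (fun i => measurable_kinkPotential _ _ _ _)
    (fun i => (measurable_kinkPotential _ _ _ _).add_const _)
    (hpot (fun i => c i / a i) (fun i => d i / b i) (fun i => p i - q i) a b p ha hb)
    (fun i => (hpot (fun i => (c i / a i)⁻¹) (fun i => (d i / b i)⁻¹) (fun i => q i - p i)
      c d q hc hd i).add (integrable_const _))
    (fun i => kinkPotential_add_le (div_pos (hc i) (ha i)) (div_pos (hd i) (hb i)) _ _)]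
  · refine Finset.sum_congr rfl fun i _ => ?_
    rw [← integral_sq_ite_affine_stdGaussian, ← integral_comp_eval
      (μ := fun _ : Fin n => gaussianReal 0 1) (i := i)]
    · refine integral_congr_ae (.of_forall fun x => ?_)
      dsimp only
      split_ifs <;> ring
    · exact (((Measurable.ite measurableSet_Iic (by fun_prop) (by fun_prop)).pow_const
        2).aestronglyMeasurable)
  · intro i x
    have := (ha i).ne'
    have := (hb i).ne'
    have := (hc i).ne'
    have := (hd i).ne'
    rw [kinkPotential_ite_affine _ _ _ _ (ha i) (hb i),
      kinkPotential_ite_affine _ _ _ _ (hc i) (hd i)]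
    split_ifs
    · field_simp
      ring
    · field_simp
      ring

/-- NFE-2 scoring function, Gaussian case: the squared 2-Wasserstein distance between the
pushforwards of the standard Gaussian measure on ℝⁿ under the componentwise piecewise
linear maps F and G. -/
theorem W2sq_piecewise_pi_pushforward_gaussian (n : ℕ)
    (hμ hσ₁ hσ₂ rμ rσ tμ tσ₁ tσ₂ : Fin n → ℝ)
    (h₁ : ∀ i, 0 < rσ i * hσ₁ i) (h₂ : ∀ i, 0 < rσ i * hσ₂ i)
    (h₃ : ∀ i, 0 < tσ₁ i) (h₄ : ∀ i, 0 < tσ₂ i) :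
    W2sqPi
      ((Measure.pi fun _ : Fin n => gaussianReal 0 1).map
        fun x i => if x i ≤ 0 then rσ i * (hσ₁ i * x i + hμ i) + rμ i
                   else rσ i * (hσ₂ i * x i + hμ i) + rμ i)
      ((Measure.pi fun _ : Fin n => gaussianReal 0 1).map
        fun x i => if x i ≤ 0 then tσ₁ i * x i + tμ i else tσ₂ i * x i + tμ i) =
      (∑ i, ((rσ * hμ + rμ - tμ) i) ^ 2)
        + (1 / 2) * (∑ i, ((|rσ * hσ₁| - |tσ₁|) i) ^ 2)
        + (1 / 2) * (∑ i, ((|rσ * hσ₂| - |tσ₂|) i) ^ 2)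
        + Real.sqrt (2 / Real.pi) *
            ∑ i, (rσ * hμ + rμ - tμ) i * (|rσ * hσ₂| - |rσ * hσ₁| + |tσ₁| - |tσ₂|) i := by
  have e : ∀ s h x m r : ℝ, s * (h * x + m) + r = s * h * x + (s * m + r) := by
    intros
    ring
  simp only [e]
  rw [W2sqPi_map_ite_affine_pi_stdGaussian (p := fun i => rσ i * hμ i + rμ i) (q := tμ) h₁ h₂ h₃ h₄]
  simp only [Pi.add_apply, Pi.sub_apply, Pi.mul_apply, Pi.abs_apply, abs_of_pos (h₁ _),
    abs_of_pos (h₂ _), abs_of_pos (h₃ _), abs_of_pos (h₄ _), Finset.mul_sum,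
    ← Finset.sum_add_distrib]
  exact Finset.sum_congr rfl fun i _ => by ring
end

section
/- Let n ∈ ℕ and let h_μ, h_σ, r_μ, r_σ, t_μ, t_σ ∈ ℝⁿ with every entry of h_σ, r_σ, t_σ nonzero. Let x₀ be the product over i of the standard Gaussian measure gaussianReal 0 1 on ℝⁿ, and define A(x) = r_σ ⊙ (h_σ ⊙ x + h_μ) + r_μ and B(x) = t_σ ⊙ x + t_μ. Then the Kullback–Leibler divergence of the pushforward measures satisfies KL(A_*x₀ ‖ B_*x₀) = Σᵢ [ log(|t_σᵢ| / (|r_σᵢ| · |h_σᵢ|)) + ((r_σᵢ·h_σᵢ)² + (r_σᵢ·h_μᵢ + r_μᵢ − t_μᵢ)²) / (2·t_σᵢ²) ] − n/2 (as extended nonnegative reals, the right-hand side being nonnegative). -/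
open MeasureTheory ProbabilityTheory
open scoped ENNReal NNReal Classical

/-- Kullback-Leibler divergence: KL(μ ‖ ν) = ∫ log(dμ/dν) dμ when μ is absolutely
continuous with respect to ν (and the log-likelihood ratio is integrable), and ∞
otherwise; valued in the extended nonnegative reals. -/
noncomputable def klDiv {α : Type*} [MeasurableSpace α] (μ ν : Measure α) : ℝ≥0∞ :=
  if μ ≪ ν ∧ Integrable (llr μ ν) μ then ENNReal.ofReal (∫ x, llr μ ν x ∂μ) else ⊤

section Pi

variable {ι : Type*} [Fintype ι] {X : ι → Type*} [∀ i, MeasurableSpace (X i)]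

lemma MeasureTheory.Measure.pi_withDensity {ν : ∀ i, Measure (X i)}
    [∀ i, IsProbabilityMeasure (ν i)] {f : ∀ i, X i → ℝ≥0∞} (hf : ∀ i, Measurable (f i))
    [∀ i, SigmaFinite ((ν i).withDensity (f i))] :
    Measure.pi (fun i => (ν i).withDensity (f i)) =
      (Measure.pi ν).withDensity fun x => ∏ i, f i (x i) := by
  refine Measure.pi_eq fun s hs => ?_
  have hg : ∀ i, Measurable ((s i).indicator (f i)) := fun i => (hf i).indicator (hs i)
  have h_ind : (Set.univ.pi s).indicator (fun x => ∏ i, f i (x i)) =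
      fun x => ∏ i, (s i).indicator (f i) (x i) := by
    ext x
    by_cases hx : x ∈ Set.univ.pi s
    · rw [Set.indicator_of_mem hx]
      exact Finset.prod_congr rfl fun i _ => (Set.indicator_of_mem (hx i trivial) _).symm
    · rw [Set.indicator_of_notMem hx]
      obtain ⟨i, hi⟩ : ∃ i, x i ∉ s i := by simpa [Set.mem_pi] using hx
      exact (Finset.prod_eq_zero (Finset.mem_univ i) (Set.indicator_of_notMem hi _)).symm
  rw [withDensity_apply _ (.univ_pi hs), ← lintegral_indicator (.univ_pi hs), h_ind]
  refine (lintegral_prod_eq_prod_lintegral_of_indepFun Finset.univ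
    (fun i (x : ∀ j, X j) => (s i).indicator (f i) (x i)) (iIndepFun_pi fun i => (hg i).aemeasurable)
    fun i => (hg i).comp (measurable_pi_apply i)).trans ?_
  refine Finset.prod_congr rfl fun i _ => ?_
  refine ((measurePreserving_eval ν i).lintegral_comp (hg i)).trans ?_
  rw [lintegral_indicator (hs i),
    withDensity_apply _ (hs i)]

variable {μ ν : ∀ i, Measure (X i)} [∀ i, IsProbabilityMeasure (μ i)]
  [∀ i, IsProbabilityMeasure (ν i)]

lemma MeasureTheory.Measure.pi_eq_withDensity_rnDeriv (h : ∀ i, μ i ≪ ν i) :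
    Measure.pi μ = (Measure.pi ν).withDensity fun x => ∏ i, (μ i).rnDeriv (ν i) (x i) := by
  have h_eq : ∀ i, (ν i).withDensity ((μ i).rnDeriv (ν i)) = μ i :=
    fun i => Measure.withDensity_rnDeriv_eq _ _ (h i)
  have : ∀ i, SigmaFinite ((ν i).withDensity ((μ i).rnDeriv (ν i))) := fun i => by
    rw [h_eq]
    infer_instance
  rw [← Measure.pi_withDensity fun i => Measure.measurable_rnDeriv _ _]
  simp_rw [h_eq]

lemma MeasureTheory.Measure.absolutelyContinuous_pi (h : ∀ i, μ i ≪ ν i) :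
    Measure.pi μ ≪ Measure.pi ν := by
  rw [Measure.pi_eq_withDensity_rnDeriv h]
  exact withDensity_absolutelyContinuous _ _

/-- The log-likelihood ratio of product measures is the sum of those of the factors. -/
lemma MeasureTheory.llr_pi (h : ∀ i, μ i ≪ ν i) :
    llr (Measure.pi μ) (Measure.pi ν) =ᵐ[Measure.pi μ] fun x => ∑ i, llr (μ i) (ν i) (x i) := by
  have h_density : (Measure.pi μ).rnDeriv (Measure.pi ν) =ᵐ[Measure.pi ν]
      fun x => ∏ i, (μ i).rnDeriv (ν i) (x i) := by
    rw [Measure.pi_eq_withDensity_rnDeriv h]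
    exact Measure.rnDeriv_withDensity _ (by fun_prop)
  have h_ne : ∀ᵐ x ∂Measure.pi μ, ∀ i, ((μ i).rnDeriv (ν i) (x i)).toReal ≠ 0 := by
    refine ae_all_iff.2 fun i => (measurePreserving_eval μ i).quasiMeasurePreserving.ae
      (p := fun y => ((μ i).rnDeriv (ν i) y).toReal ≠ 0) ?_
    filter_upwards [Measure.rnDeriv_pos (h i), (h i).ae_le (Measure.rnDeriv_ne_top (μ i) (ν i))]
      with y hy hy'
    exact ENNReal.toReal_ne_zero.2 ⟨hy.ne', hy'⟩
  filter_upwards [(Measure.absolutelyContinuous_pi h).ae_le h_density, h_ne] with x hx hx'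
  simp only [llr_def, hx, ENNReal.toReal_prod]
  exact Real.log_prod fun i _ => hx' i

lemma klDiv_pi (h : ∀ i, μ i ≪ ν i) (h_int : ∀ i, Integrable (llr (μ i) (ν i)) (μ i)) :
    klDiv (Measure.pi μ) (Measure.pi ν) =
      ENNReal.ofReal (∑ i, ∫ x, llr (μ i) (ν i) x ∂(μ i)) := by
  have h_comp : ∀ i, Integrable (fun x => llr (μ i) (ν i) (x i)) (Measure.pi μ) :=
    fun i => integrable_comp_eval (h_int i)
  rw [klDiv, if_pos ⟨Measure.absolutelyContinuous_pi h,
    (integrable_finsetSum _ fun i _ => h_comp i).congr (llr_pi h).symm⟩,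
    integral_congr_ae (llr_pi h), integral_finsetSum _ fun i _ => h_comp i]
  congr 1
  exact Finset.sum_congr rfl fun i _ => integral_comp_eval (h_int i).aestronglyMeasurable

end Pi

section Gaussian

variable {m₁ m₂ : ℝ} {v₁ v₂ : ℝ≥0}

lemma gaussianReal_absolutelyContinuous_gaussianReal (h₁ : v₁ ≠ 0) (h₂ : v₂ ≠ 0) :
    gaussianReal m₁ v₁ ≪ gaussianReal m₂ v₂ :=
  (gaussianReal_absolutelyContinuous m₁ h₁).trans (gaussianReal_absolutelyContinuous' m₂ h₂)

lemma log_gaussianPDFReal (m : ℝ) {v : ℝ≥0} (hv : v ≠ 0) (x : ℝ) :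
    Real.log (gaussianPDFReal m v x) =
      -(Real.log (2 * Real.pi) + Real.log v) / 2 - (x - m) ^ 2 / (2 * v) := by
  have hv' : (0 : ℝ) < v := by positivity
  have hpi := Real.pi_pos
  rw [gaussianPDFReal, Real.log_mul (by positivity) (Real.exp_ne_zero _), Real.log_exp,
    Real.log_inv, Real.log_sqrt (by positivity), Real.log_mul (by positivity) hv'.ne']
  ring

lemma llr_gaussianReal (h₁ : v₁ ≠ 0) (h₂ : v₂ ≠ 0) :
    llr (gaussianReal m₁ v₁) (gaussianReal m₂ v₂) =ᵐ[gaussianReal m₁ v₁] fun x =>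
      (Real.log v₂ - Real.log v₁) / 2 - (x - m₁) ^ 2 / (2 * v₁) + (x - m₂) ^ 2 / (2 * v₂) := by
  have h_ac := gaussianReal_absolutelyContinuous_gaussianReal (m₁ := m₁) (m₂ := m₂) h₁ h₂
  have h_vol := gaussianReal_absolutelyContinuous m₁ h₁
  filter_upwards [h_vol.ae_le (Measure.rnDeriv_mul_rnDeriv (κ := volume) h_ac),
    h_vol.ae_le (rnDeriv_gaussianReal m₁ v₁), h_vol.ae_le (rnDeriv_gaussianReal m₂ v₂)]
    with x hx hx₁ hx₂
  rw [Pi.mul_apply, hx₁, hx₂] at hx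
  have h_real := congrArg ENNReal.toReal hx
  rw [ENNReal.toReal_mul, toReal_gaussianPDF, toReal_gaussianPDF] at h_real
  have h_pos₁ := gaussianPDFReal_pos m₁ v₁ x h₁
  have h_pos₂ := gaussianPDFReal_pos m₂ v₂ x h₂
  rw [llr, eq_div_of_mul_eq h_pos₂.ne' h_real, Real.log_div h_pos₁.ne' h_pos₂.ne',
    log_gaussianPDFReal _ h₁, log_gaussianPDFReal _ h₂]
  ring

lemma memLp_sub_const_gaussianReal (m : ℝ) (v : ℝ≥0) (c : ℝ) :
    MemLp (fun x => x - c) 2 (gaussianReal m v) :=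
  (memLp_id_gaussianReal 2).sub (memLp_const c)

lemma integral_sub_const_sq_gaussianReal (m : ℝ) (v : ℝ≥0) (c : ℝ) :
    ∫ x, (x - c) ^ 2 ∂gaussianReal m v = v + (m - c) ^ 2 := by
  have h_var := variance_eq_sub (memLp_sub_const_gaussianReal m v c)
  rw [variance_sub_const (by fun_prop), variance_fun_id_gaussianReal,
    integral_sub (f := fun x => x) ((memLp_id_gaussianReal 1).integrable le_rfl)
      (integrable_const c)] at h_var
  simp only [Pi.pow_apply, integral_id_gaussianReal, integral_const, probReal_univ, one_smul]
    at h_var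
  linarith

lemma integrable_sub_const_sq_div_gaussianReal (m : ℝ) (v : ℝ≥0) (c s : ℝ) :
    Integrable (fun x => (x - c) ^ 2 / s) (gaussianReal m v) :=
  (memLp_sub_const_gaussianReal m v c).integrable_sq.div_const s

lemma integrable_llr_gaussianReal (h₁ : v₁ ≠ 0) (h₂ : v₂ ≠ 0) :
    Integrable (llr (gaussianReal m₁ v₁) (gaussianReal m₂ v₂)) (gaussianReal m₁ v₁) :=
  (((integrable_const _).sub (integrable_sub_const_sq_div_gaussianReal ..)).add
    (integrable_sub_const_sq_div_gaussianReal ..)).congr (llr_gaussianReal h₁ h₂).symm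

lemma integral_llr_gaussianReal (h₁ : v₁ ≠ 0) (h₂ : v₂ ≠ 0) :
    ∫ x, llr (gaussianReal m₁ v₁) (gaussianReal m₂ v₂) x ∂gaussianReal m₁ v₁ =
      (Real.log v₂ - Real.log v₁) / 2 + (v₁ + (m₁ - m₂) ^ 2) / (2 * v₂) - 1 / 2 := by
  have h_int := integrable_sub_const_sq_div_gaussianReal m₁ v₁
  have h_sub : Integrable (fun x => (Real.log v₂ - Real.log v₁) / 2 - (x - m₁) ^ 2 / (2 * v₁))
      (gaussianReal m₁ v₁) := (integrable_const _).sub (h_int ..)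
  have hv₁ : (v₁ : ℝ) ≠ 0 := by positivity
  rw [integral_congr_ae (llr_gaussianReal h₁ h₂),
    integral_add h_sub (h_int ..),
    integral_sub (integrable_const _) (h_int ..), integral_div, integral_div, integral_div,
    integral_sub_const_sq_gaussianReal, integral_sub_const_sq_gaussianReal]
  simp only [integral_const, probReal_univ, one_smul, sub_self]
  field_simp
  ring

lemma gaussianReal_map_affine (m : ℝ) (v : ℝ≥0) (a b : ℝ) :
    (gaussianReal m v).map (fun x => a * x + b) =
      gaussianReal (a * m + b) (.mk (a ^ 2) (sq_nonneg _) * v) := by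
  rw [← gaussianReal_map_add_const, ← gaussianReal_map_const_mul,
    Measure.map_map (by fun_prop) (by fun_prop)]
  rfl

lemma pi_gaussianReal_map_affine {ι : Type*} [Fintype ι] (a b : ι → ℝ) :
    (Measure.pi fun _ : ι => gaussianReal 0 1).map (fun x => a * x + b) =
      Measure.pi fun i => gaussianReal (b i) (.mk (a i ^ 2) (sq_nonneg _)) := by
  have h_map : ∀ i, (gaussianReal 0 1).map (fun x => a i * x + b i) =
      gaussianReal (b i) (.mk (a i ^ 2) (sq_nonneg _)) := fun i => by
    simp [gaussianReal_map_affine]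
  have : ∀ i, SigmaFinite ((gaussianReal 0 1).map fun x => a i * x + b i) := fun i => by
    rw [h_map]
    infer_instance
  simp_rw [← h_map]
  exact Measure.pi_map_pi (f := fun i x => a i * x + b i) fun i => by fun_prop

end Gaussian

/-- The KL divergence between the pushforwards of the standard Gaussian measure on ℝⁿ
under the affine maps A(x) = r_σ ⊙ (h_σ ⊙ x + h_μ) + r_μ and B(x) = t_σ ⊙ x + t_μ. -/
theorem klDiv_affine_pushforward_gaussian (n : ℕ) (hμ hσ rμ rσ tμ tσ : Fin n → ℝ)
    (hhσ : ∀ i, hσ i ≠ 0) (hrσ : ∀ i, rσ i ≠ 0) (htσ : ∀ i, tσ i ≠ 0) :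
    klDiv
      ((Measure.pi fun _ : Fin n => gaussianReal 0 1).map
        fun x => rσ * (hσ * x + hμ) + rμ)
      ((Measure.pi fun _ : Fin n => gaussianReal 0 1).map
        fun x => tσ * x + tμ) =
      ENNReal.ofReal
        ((∑ i, (Real.log (|tσ i| / (|rσ i| * |hσ i|))
            + ((rσ i * hσ i) ^ 2 + (rσ i * hμ i + rμ i - tμ i) ^ 2) / (2 * tσ i ^ 2)))
          - n / 2) := by
  have h_affine : (fun x : Fin n → ℝ => rσ * (hσ * x + hμ) + rμ) =
      fun x => (rσ * hσ) * x + (rσ * hμ + rμ) := by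
    ext x i
    simp only [Pi.add_apply, Pi.mul_apply]
    ring
  have h_var : ∀ a : ℝ, a ≠ 0 → (NNReal.mk (a ^ 2) (sq_nonneg a)) ≠ 0 := fun a ha h =>
    pow_ne_zero 2 ha (congrArg NNReal.toReal h)
  have h_left : ∀ i, NNReal.mk ((rσ * hσ) i ^ 2) (sq_nonneg _) ≠ 0 := fun i =>
    h_var _ (mul_ne_zero (hrσ i) (hhσ i))
  have h_right : ∀ i, NNReal.mk (tσ i ^ 2) (sq_nonneg _) ≠ 0 := fun i => h_var _ (htσ i)
  rw [h_affine, pi_gaussianReal_map_affine, pi_gaussianReal_map_affine,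
    klDiv_pi
      (fun i => gaussianReal_absolutelyContinuous_gaussianReal (h_left i) (h_right i))
      (fun i => integrable_llr_gaussianReal (h_left i) (h_right i))]
  have h_half : (n : ℝ) / 2 = ∑ _i : Fin n, (1 / 2 : ℝ) := by
    simp [div_eq_mul_inv]
  rw [h_half, ← Finset.sum_sub_distrib]
  congr 1
  refine Finset.sum_congr rfl fun i _ => ?_
  rw [integral_llr_gaussianReal (h_left i) (h_right i), ← abs_mul,
    Real.log_div (abs_ne_zero.2 (htσ i)) (abs_ne_zero.2 (mul_ne_zero (hrσ i) (hhσ i))),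
    Real.log_abs, Real.log_abs]
  simp only [NNReal.coe_mk, Pi.mul_apply, Pi.add_apply, Real.log_pow, Nat.cast_ofNat]
  ring
end
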